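/- Let n ≥ 11 and let T be a tree of order n that attains the second-largest number of dissociation sets among all trees of order n (i.e., T maximizes d among all trees of order n that do not attain the maximum value of d over trees of order n). Let P = v_0 v_1 v_2 ⋯ v_l be a longest path in T. Then the vertex v_1 has degree exactly 2 in T. -/

import Mathlib

open SimpleGraph

/-- `S` is a dissociation set of `G`: every vertex of `S` has at most one neighbor in `S`. -/
def IsDissociation {V : Type*} (G : SimpleGraph V) (S : Set V) : Prop :=
  ∀ v ∈ S, (G.neighborSet v ∩ S).Subsingleton

/-- `d(G)`: the number of dissociation sets of `G`. -/
noncomputable def dissocNum {V : Type*} (G : SimpleGraph V) : ℕ :=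
  Nat.card {S : Set V // IsDissociation G S}

/-- `K_{r+1} ∗ (K_{s₀+1} ∪ ⋯ ∪ K_{sₜ+1})`: the hub `Sum.inl 0` of the complete graph
`K_{r+1}` is joined to the vertex `0` of each complete component. -/
def starGraph (r : ℕ) (s : List ℕ) :
    SimpleGraph (Fin (r + 1) ⊕ (Σ i : Fin s.length, Fin (s.get i + 1))) where
  Adj x y := x ≠ y ∧
    (Sum.elim (fun _ => (none : Option (Fin s.length))) (fun p => some p.1) x =
        Sum.elim (fun _ => (none : Option (Fin s.length))) (fun p => some p.1) y ∨
      (x = Sum.inl 0 ∧ ∃ i, y = Sum.inr ⟨i, 0⟩) ∨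
      (y = Sum.inl 0 ∧ ∃ i, x = Sum.inr ⟨i, 0⟩))
  symm := by
    constructor
    rintro x y ⟨h1, h2⟩
    refine ⟨h1.symm, ?_⟩
    rcases h2 with h | h | h
    · exact Or.inl h.symm
    · exact Or.inr (Or.inr h)
    · exact Or.inr (Or.inl h)
  loopless := ⟨fun x h => h.1 rfl⟩

/-- `T` attains the second-largest number of dissociation sets among all trees of order `n`:
`T` is a tree of order `n` that does not attain the maximum of `d` over trees of order `n`,
and `d(T)` is largest among such trees. -/
def SecondLargestTree (n : ℕ) (T : SimpleGraph (Fin n)) : Prop :=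
  T.IsTree ∧
  (∃ T' : SimpleGraph (Fin n), T'.IsTree ∧ dissocNum T < dissocNum T') ∧
  (∀ T' : SimpleGraph (Fin n), T'.IsTree →
    (∃ T'' : SimpleGraph (Fin n), T''.IsTree ∧ dissocNum T' < dissocNum T'') →
    dissocNum T' ≤ dissocNum T)

/-- Weight of a vertex `v` in a partially eliminated tree: the numbers of configurations of the
eliminated part at `v` in which `v` is not selected, is selected without a selected neighbor,
and is selected with exactly one selected neighbor. -/
abbrev VertexWeight := ℕ × ℕ × ℕ

/-- The weight of a vertex of weight `w` after a pendant neighbor of weight `c` is eliminated. -/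
def attachLeaf (c w : VertexWeight) : VertexWeight :=
  (w.1 * (c.1 + c.2.1 + c.2.2), w.2.1 * c.1, w.2.2 * c.1 + w.2.1 * c.2.1)

/-- Eliminate the vertices `N - 1, …, 1` of the tree on `{0, …, N - 1}` with parent function `p`
and return the total weight. -/
def elimAll (p : ℕ → ℕ) : ℕ → (ℕ → VertexWeight) → ℕ
  | 0, _ => 1
  | 1, w => (w 0).1 + (w 0).2.1 + (w 0).2.2
  | N + 2, w => elimAll p (N + 1)
      (Function.update w (p (N + 1)) (attachLeaf (w (N + 1)) (w (p (N + 1)))))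

/-- Checks that `elimAll p N` is at most `B` for every monotone parent function `p` with
`p (N - 1) ≤ c`; the list holds the weights of the vertices `N - 1, …, 0`. -/
def elimBound (B : ℕ) : ℕ → ℕ → List VertexWeight → Bool
  | _, 0, _ => true
  | _, 1, L => match L with
    | w :: _ => (w.1 + w.2.1 + w.2.2).ble B
    | [] => true
  | c, N + 2, L => match L with
    | w :: L => (List.range (min c N + 1)).all fun q =>
        elimBound B q (N + 1) (L.modify (N - q) (attachLeaf w))
    | [] => true

theorem elimAll_le_of_elimBound {B : ℕ} {p : ℕ → ℕ} : ∀ (N c : ℕ) (L : List VertexWeight)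
    (w : ℕ → VertexWeight), elimBound B c (N + 1) L = true →
    (∀ i ≤ N, L[N - i]? = some (w i)) → (∀ i, 0 < i → i ≤ N → p i < i) →
    (∀ i < N, p i ≤ p (i + 1)) → p N ≤ c → elimAll p (N + 1) w ≤ B := by
  intro N
  induction N with
  | zero =>
    intro c L w hb hL _ _ _
    have h0 := hL 0 le_rfl
    cases L with
    | nil => simp at h0
    | cons a L =>
      simp at h0
      subst h0
      simpa [elimBound, elimAll, Nat.ble_eq] using hb
  | succ N ih =>
    intro c L w hb hL hp hmono hc
    have h0 := hL (N + 1) le_rfl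
    cases L with
    | nil => simp at h0
    | cons a L =>
      simp at h0
      subst h0
      simp only [elimBound, List.all_eq_true, List.mem_range] at hb
      have hpN := hp (N + 1) (by omega) le_rfl
      have hb' := hb (p (N + 1)) (by omega)
      rw [elimAll]
      refine ih _ _ _ hb' ?_ (fun i hi hiN => hp i hi (by omega))
        (fun i hi => hmono i (by omega)) (hmono N (by omega))
      intro i hi
      have hLi := hL i (by omega)
      rw [show N + 1 - i = (N - i) + 1 by omega, List.getElem?_cons_succ] at hLi
      rw [List.getElem?_modify, hLi]
      by_cases h : i = p (N + 1)
      · subst h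
        simp
      · rw [Function.update_of_ne h]
        simp
        omega

open Classical in
/-- The dissociation sets of `G` contained in `A`. -/
noncomputable def dissocFinset {V : Type*} (G : SimpleGraph V) (A : Finset V) :
    Finset (Finset V) :=
  A.powerset.filter fun S => IsDissociation G (S : Set V)

theorem mem_dissocFinset {V : Type*} {G : SimpleGraph V} {A S : Finset V} :
    S ∈ dissocFinset G A ↔ S ⊆ A ∧ IsDissociation G (S : Set V) := by
  simp [dissocFinset]

theorem IsDissociation.mono {V : Type*} {G : SimpleGraph V} {S T : Set V}
    (hT : IsDissociation G T) (h : S ⊆ T) : IsDissociation G S := fun v hv =>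
  (hT v (h hv)).anti (Set.inter_subset_inter_right _ h)

theorem isDissociation_iff {V : Type*} {G : SimpleGraph V} {S : Set V} : IsDissociation G S ↔
    ∀ v ∈ S, ∀ x ∈ S, ∀ y ∈ S, G.Adj v x → G.Adj v y → x = y := by
  simp only [IsDissociation, Set.Subsingleton, Set.mem_inter_iff, mem_neighborSet]
  grind

open Classical in
/-- The factor of the vertex `v` in the weight of the dissociation set `S`. -/
noncomputable def stateWeight {V : Type*} (G : SimpleGraph V) (w : V → VertexWeight)
    (S : Finset V) (v : V) : ℕ :=
  if v ∈ S then (if ∃ u ∈ S, G.Adj v u then (w v).2.1 else (w v).2.1 + (w v).2.2) else (w v).1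

open Classical in
/-- The total weight of the dissociation sets contained in `A`. -/
noncomputable def dissocWeight {V : Type*} (G : SimpleGraph V) (A : Finset V)
    (w : V → VertexWeight) : ℕ :=
  ∑ S ∈ A.powerset, if IsDissociation G (S : Set V) then ∏ v ∈ A, stateWeight G w S v else 0

theorem dissocWeight_one {V : Type*} (G : SimpleGraph V) (A : Finset V) :
    dissocWeight G A (fun _ => (1, 1, 0)) = (dissocFinset G A).card := by
  classical
  simp only [dissocWeight, stateWeight, dissocFinset, Finset.card_filter]
  refine Finset.sum_congr rfl fun S _ => ?_
  simp

theorem isDissociation_insert_leaf {V : Type*} [DecidableEq V] {G : SimpleGraph V}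
    {S : Finset V} {u q : V} (hu : u ∉ S) (hq : ∀ v ∈ S, G.Adj u v ↔ v = q) :
    IsDissociation G (↑(insert u S) : Set V) ↔
      IsDissociation G (S : Set V) ∧ (q ∈ S → ¬ ∃ x ∈ S, G.Adj q x) := by
  simp only [isDissociation_iff, Finset.coe_insert, Set.mem_insert_iff, Finset.mem_coe]
  constructor
  · intro h
    refine ⟨fun v hv x hx y hy => h v (.inr hv) x (.inr hx) y (.inr hy), ?_⟩
    rintro hqS ⟨x, hx, hqx⟩
    have hxu := h q (.inr hqS) x (.inr hx) u (.inl rfl) hqx ((hq q hqS).2 rfl).symm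
    exact hu (hxu ▸ hx)
  · rintro ⟨h, hn⟩ v hv x hx y hy hvx hvy
    have key : ∀ z ∈ S, G.Adj z u → z = q := fun z hz hzu => (hq z hz).1 hzu.symm
    have irr : ∀ z, ¬ G.Adj z z := fun z => G.loopless.irrefl z
    have key2 : ∀ z ∈ S, G.Adj u z → z = q := fun z hz hzu => (hq z hz).1 hzu
    rcases hv with rfl | hv
    · grind
    · rcases hx with rfl | hx <;> rcases hy with rfl | hy
      · rfl
      · exact absurd ⟨y, hy, key v hv hvx ▸ hvy⟩ (hn (key v hv hvx ▸ hv))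
      · exact absurd ⟨x, hx, key v hv hvy ▸ hvx⟩ (hn (key v hv hvy ▸ hv))
      · exact h v hv x hx y hy hvx hvy

theorem dissocWeight_insert_leaf {V : Type*} [DecidableEq V] (G : SimpleGraph V) {A : Finset V}
    {u q : V} (hu : u ∉ A) (hqA : q ∈ A) (hq : ∀ v ∈ A, G.Adj u v ↔ v = q)
    (w : V → VertexWeight) :
    dissocWeight G (insert u A) w =
      dissocWeight G A (Function.update w q (attachLeaf (w u) (w q))) := by
  classical
  rw [dissocWeight, Finset.sum_powerset_insert hu, ← Finset.sum_add_distrib, dissocWeight]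
  refine Finset.sum_congr rfl fun S hS => ?_
  rw [Finset.mem_powerset] at hS
  have huS : u ∉ S := fun h => hu (hS h)
  have huq : G.Adj u q := (hq q hqA).2 rfl
  rw [isDissociation_insert_leaf huS fun v hv => hq v (hS hv)]
  by_cases hd : IsDissociation G (S : Set V)
  swap
  · simp [hd]
  rw [Finset.prod_insert hu, Finset.prod_insert hu, ← Finset.mul_prod_erase A _ hqA,
    ← Finset.mul_prod_erase A _ hqA, ← Finset.mul_prod_erase A _ hqA]
  have h1 : ∏ v ∈ A.erase q, stateWeight G w (insert u S) v =
      ∏ v ∈ A.erase q, stateWeight G w S v := by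
    refine Finset.prod_congr rfl fun v hv => ?_
    obtain ⟨hvq, hvA⟩ := Finset.mem_erase.1 hv
    have hvu : v ≠ u := fun h => hu (h ▸ hvA)
    have hnot : ¬ G.Adj v u := fun h => hvq ((hq v hvA).1 h.symm)
    simp [stateWeight, hvu, hnot]
  have h2 : ∏ v ∈ A.erase q, stateWeight G (Function.update w q (attachLeaf (w u) (w q))) S v =
      ∏ v ∈ A.erase q, stateWeight G w S v := by
    refine Finset.prod_congr rfl fun v hv => ?_
    simp [stateWeight, Function.update_of_ne (Finset.ne_of_mem_erase hv)]
  rw [h1, h2]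
  have hqu : q ≠ u := fun h => hu (h ▸ hqA)
  have hex : (∃ x ∈ S, G.Adj u x) ↔ q ∈ S :=
    ⟨fun ⟨x, hx, h⟩ => (hq x (hS hx)).1 h ▸ hx, fun h => ⟨q, h, huq⟩⟩
  generalize ∏ v ∈ A.erase q, stateWeight G w S v = P
  by_cases hqS : q ∈ S
  · by_cases hn : ∃ x ∈ S, G.Adj q x
    · simp only [stateWeight, hd, hqS, hn, huS, attachLeaf, Function.update_self]
      simp
      ring
    · have hn' : ∃ x ∈ insert u S, G.Adj q x := ⟨u, by simp, huq.symm⟩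
      have hm' : ∃ x ∈ insert u S, G.Adj u x := ⟨q, by simp [hqS], huq⟩
      simp only [stateWeight, hd, hqS, hn, hn', hm', huS, attachLeaf, Function.update_self,
        Finset.mem_insert_self, Finset.mem_insert_of_mem hqS, if_true, if_false, true_and, not_false_eq_true,
        imp_self]
      ring
  · have hm' : ¬ ∃ x ∈ insert u S, G.Adj u x := by
      rw [Finset.exists_mem_insert, hex]
      simp [hqS]
    have hqi : q ∉ insert u S := by simp [hqS, hqu]
    simp only [stateWeight, hd, hqS, hm', hqi, huS, attachLeaf, Function.update_self,
      Finset.mem_insert_self, if_true, if_false, true_and, false_imp_iff]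
    ring

/-- The graph on `ℕ` in which every `i ≠ 0` is joined to its parent `p i`. -/
def parentGraph (p : ℕ → ℕ) : SimpleGraph ℕ :=
  SimpleGraph.fromRel fun i j => i ≠ 0 ∧ p i = j

theorem dissocWeight_parentGraph {p : ℕ → ℕ} (N : ℕ) : ∀ w : ℕ → VertexWeight,
    (∀ i, 0 < i → i ≤ N → p i < i) →
    dissocWeight (parentGraph p) (Finset.range (N + 1)) w = elimAll p (N + 1) w := by
  induction N with
  | zero =>
    intro w _
    have hs : IsDissociation (parentGraph p) ({0} : Set ℕ) := by
      rw [isDissociation_iff]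
      grind
    have he : IsDissociation (parentGraph p) (∅ : Set ℕ) := by
      rw [isDissociation_iff]
      grind
    rw [zero_add, Finset.range_one, ← insert_empty_eq, dissocWeight,
      Finset.sum_powerset_insert (by simp)]
    simp [he, hs, stateWeight, elimAll]
    ring
  | succ N ih =>
    intro w hp
    have hpN := hp (N + 1) (by omega) le_rfl
    rw [Finset.range_add_one, dissocWeight_insert_leaf (q := p (N + 1)) _ (by simp)
      (by simpa using hpN), ih _ fun i hi hiN => hp i hi (by omega), elimAll]
    intro v hv
    rw [Finset.mem_range] at hv
    have hpv : v ≠ 0 → p v < v := fun h => hp v (by omega) (by omega)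
    simp only [parentGraph, fromRel_adj]
    omega

theorem dissocNum_eq_card_dissocFinset {V : Type*} [Fintype V] (G : SimpleGraph V) :
    dissocNum G = (dissocFinset G Finset.univ).card := by
  classical
  rw [dissocNum, ← Nat.card_eq_finsetCard]
  refine Nat.card_congr ((Fintype.finsetEquivSet (α := V) |>.symm).subtypeEquiv fun S => ?_)
  simp [mem_dissocFinset]

theorem card_dissocFinset_le_two_pow {V : Type*} (G : SimpleGraph V) (A : Finset V) :
    (dissocFinset G A).card ≤ 2 ^ A.card := by
  classical
  rw [← Finset.card_powerset]
  exact Finset.card_filter_le _ _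

theorem card_dissocFinset_le_mul {V : Type*} (G : SimpleGraph V) {A B : Finset V} (h : A ⊆ B) :
    (dissocFinset G B).card ≤ (dissocFinset G A).card * 2 ^ (B.card - A.card) := by
  classical
  rw [← Finset.card_sdiff_of_subset h, ← Finset.card_powerset, ← Finset.card_product]
  refine Finset.card_le_card_of_injOn (fun S => (S ∩ A, S \ A)) ?_ ?_
  · intro S hS
    obtain ⟨hSB, hS⟩ := mem_dissocFinset.1 hS
    simp only [Finset.coe_product, Set.mem_prod, Finset.mem_coe, mem_dissocFinset,
      Finset.mem_powerset]
    exact ⟨⟨Finset.inter_subset_right, hS.mono (by simp)⟩, Finset.sdiff_subset_sdiff hSB le_rfl⟩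
  · intro S _ T _ h
    simp only [Prod.mk.injEq] at h
    rw [← Finset.sdiff_union_inter S A, ← Finset.sdiff_union_inter T A, h.1, h.2]

theorem card_dissocFinset_comap {V W : Type*} (G : SimpleGraph W) (e : V ↪ W) (A : Finset V) :
    (dissocFinset (G.comap e) A).card = (dissocFinset G (A.map e)).card := by
  classical
  refine Finset.card_nbij (fun S => S.map e) ?_ ?_ ?_
  · intro S hS
    rw [Finset.mem_coe, mem_dissocFinset, isDissociation_iff] at hS ⊢
    refine ⟨Finset.map_subset_map.2 hS.1, ?_⟩
    simpa using hS.2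
  · exact (Finset.map_injective e).injOn
  · intro S hS
    rw [Finset.mem_coe, mem_dissocFinset] at hS
    obtain ⟨hSA, hS⟩ := hS
    obtain ⟨U, hU, rfl⟩ := Finset.subset_map_iff.1 hSA
    refine ⟨U, ?_, rfl⟩
    rw [Finset.mem_coe, mem_dissocFinset, isDissociation_iff]
    rw [isDissociation_iff] at hS
    exact ⟨hU, by simpa using hS⟩

theorem card_dissocFinset_image_range_le {V : Type*} [DecidableEq V] (G : SimpleGraph V) {N : ℕ}
    {f : ℕ → V} {p : ℕ → ℕ} (hf : Set.InjOn f (Set.Iio N))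
    (hp : ∀ i, 0 < i → i < N → G.Adj (f (p i)) (f i)) :
    (dissocFinset G ((Finset.range N).image f)).card ≤
      (dissocFinset (parentGraph p) (Finset.range N)).card := by
  refine Finset.card_le_card_of_injOn (fun S => (Finset.range N).filter fun i => f i ∈ S) ?_ ?_
  · intro S hS
    rw [Finset.mem_coe, mem_dissocFinset, isDissociation_iff] at hS ⊢
    refine ⟨Finset.filter_subset _ _, ?_⟩
    have hadj : ∀ i < N, ∀ j < N, (parentGraph p).Adj i j → G.Adj (f i) (f j) := by
      intro i hi j hj hij
      rw [parentGraph, fromRel_adj] at hij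
      rcases hij with ⟨-, ⟨h0, rfl⟩ | ⟨h0, rfl⟩⟩
      · exact (hp i (by omega) hi).symm
      · exact hp j (by omega) hj
    simp only [Finset.coe_filter, Finset.mem_range, Set.mem_ofPred_eq]
    intro v hv x hx y hy hvx hvy
    exact hf hx.1 hy.1 (hS.2 _ hv.2 _ hx.2 _ hy.2 (hadj _ hv.1 _ hx.1 hvx)
      (hadj _ hv.1 _ hy.1 hvy))
  · intro S hS T hT h
    rw [Finset.mem_coe, mem_dissocFinset] at hS hT
    have key : ∀ i < N, (f i ∈ S ↔ f i ∈ T) := fun i hi => by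
      have := congrArg (i ∈ ·) h
      simpa [hi] using this
    ext v
    constructor
    · intro hv
      obtain ⟨i, hi, rfl⟩ := Finset.mem_image.1 (hS.1 hv)
      exact (key i (Finset.mem_range.1 hi)).1 hv
    · intro hv
      obtain ⟨i, hi, rfl⟩ := Finset.mem_image.1 (hT.1 hv)
      exact (key i (Finset.mem_range.1 hi)).2 hv

/-- Breadth-first enumeration of the first `N + 1` vertices of a connected set `B`, with a
monotone parent function. -/
theorem exists_breadthFirst {V : Type*} [DecidableEq V] {G : SimpleGraph V} {B : Finset V} {r : V}
    (hr : r ∈ B)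
    (hB : ∀ X ⊆ B, r ∈ X → X ≠ B → ∃ x ∈ X, ∃ y ∈ B, y ∉ X ∧ G.Adj x y) (N : ℕ)
    (hN : N + 1 ≤ B.card) :
    ∃ (f : ℕ → V) (p : ℕ → ℕ), f 0 = r ∧ (∀ i ≤ N, f i ∈ B) ∧
      (∀ i ≤ N, ∀ j ≤ N, f i = f j → i = j) ∧
      (∀ i, 0 < i → i ≤ N → p i < i) ∧ (∀ i, 0 < i → i ≤ N → G.Adj (f (p i)) (f i)) ∧
      (∀ i < N, p i ≤ p (i + 1)) ∧
      (∀ j < p N, ∀ y ∈ B, G.Adj (f j) y → ∃ i ≤ N, f i = y) := by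
  induction N with
  | zero => exact ⟨fun _ => r, fun _ => 0, by simp, by simp [hr], by simp, by omega, by omega,
      by simp, by simp⟩
  | succ N ih =>
    obtain ⟨f, p, hf0, hfB, hinj, hlt, hadj, hmono, hinv⟩ := ih (by omega)
    have hex : ∃ j, j ≤ N ∧ ∃ y ∈ B, G.Adj (f j) y ∧ ∀ i ≤ N, f i ≠ y := by
      obtain ⟨x, hx, y, hy, hyX, hxy⟩ := hB ((Finset.range (N + 1)).image f)
        (by
          intro x hx
          obtain ⟨i, hi, rfl⟩ := Finset.mem_image.1 hx
          exact hfB i (by simpa [Nat.lt_succ_iff] using hi))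
        (Finset.mem_image.2 ⟨0, by simp, hf0⟩)
        (by
          intro h
          have := Finset.card_image_le (s := Finset.range (N + 1)) (f := f)
          rw [h, Finset.card_range] at this
          omega)
      obtain ⟨j, hj, rfl⟩ := Finset.mem_image.1 hx
      refine ⟨j, by simpa [Nat.lt_succ_iff] using hj, y, hy, hxy, fun i hi h => hyX ?_⟩
      exact Finset.mem_image.2 ⟨i, by simpa [Nat.lt_succ_iff] using hi, h⟩
    classical
    obtain ⟨hjN, y, hy, hjy, hnew⟩ := Nat.find_spec hex
    have hmin := fun j (hj : j < Nat.find hex) => Nat.find_min hex hj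
    generalize Nat.find hex = j at hjN hjy hmin
    have hpj : p N ≤ j := by
      by_contra! h
      obtain ⟨i, hi, hiy⟩ := hinv j h y hy hjy
      exact hnew i hi hiy
    have hfu : ∀ i ≤ N, Function.update f (N + 1) y i = f i := fun i hi =>
      Function.update_of_ne (by omega) _ _
    have hpu : ∀ i ≤ N, Function.update p (N + 1) j i = p i := fun i hi =>
      Function.update_of_ne (by omega) _ _
    have hfs : Function.update f (N + 1) y (N + 1) = y := Function.update_self _ _ _
    have hps : Function.update p (N + 1) j (N + 1) = j := Function.update_self _ _ _
    generalize Function.update f (N + 1) y = f' at hfu hfs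
    generalize Function.update p (N + 1) j = p' at hpu hps
    have split : ∀ i, i ≤ N + 1 → i ≤ N ∨ i = N + 1 := by omega
    refine ⟨f', p', by rw [hfu 0 (by omega), hf0], ?_, ?_, ?_, ?_, ?_, ?_⟩
    · intro i hi
      rcases split i hi with h | rfl
      · rw [hfu i h]
        exact hfB i h
      · rwa [hfs]
    · intro i hi k hk h
      rcases split i hi with h1 | rfl <;> rcases split k hk with h2 | rfl
      · rw [hfu i h1, hfu k h2] at h
        exact hinj i h1 k h2 h
      · rw [hfu i h1, hfs] at h
        exact absurd h (hnew i h1)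
      · rw [hfu k h2, hfs] at h
        exact absurd h.symm (hnew k h2)
      · rfl
    · intro i h0 hi
      rcases split i hi with h | rfl
      · rw [hpu i h]
        exact hlt i h0 h
      · omega
    · intro i h0 hi
      rcases split i hi with h | rfl
      · have := hlt i h0 h
        rw [hpu i h, hfu i h, hfu _ (by omega)]
        exact hadj i h0 h
      · rw [hps, hfs, hfu j hjN]
        exact hjy
    · intro i hi
      rcases split (i + 1) (by omega) with h | h
      · rw [hpu i (by omega), hpu _ h]
        exact hmono i (by omega)
      · obtain rfl : i = N := by omega
        rw [hps, hpu i le_rfl]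
        exact hpj
    · intro k hk z hz hkz
      rw [hps] at hk
      have hm := hmin k hk
      push Not at hm
      rw [hfu k (by omega)] at hkz
      obtain ⟨i, hi, hiz⟩ := hm (by omega) z hz hkz
      exact ⟨i, by omega, by rw [hfu i hi, hiz]⟩

theorem card_dissocFinset_le_of_elimBound {V : Type*} [DecidableEq V] {G : SimpleGraph V}
    {B : Finset V} {r : V} (hr : r ∈ B)
    (hB : ∀ X ⊆ B, r ∈ X → X ≠ B → ∃ x ∈ X, ∃ y ∈ B, y ∉ X ∧ G.Adj x y) {N b : ℕ}
    (hN0 : 0 < N) (hN : N + 1 ≤ B.card)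
    (hb : elimBound b N (N + 1) (List.replicate (N + 1) (1, 1, 0)) = true) :
    (dissocFinset G B).card ≤ b * 2 ^ (B.card - (N + 1)) := by
  obtain ⟨f, p, hf0, hfB, hinj, hlt, hadj, hmono, -⟩ := exists_breadthFirst hr hB N hN
  have hinj' : Set.InjOn f (Set.Iio (N + 1)) := fun i hi j hj h =>
    hinj i (Nat.lt_succ_iff.1 hi) j (Nat.lt_succ_iff.1 hj) h
  have hsub : (Finset.range (N + 1)).image f ⊆ B := by
    intro x hx
    obtain ⟨i, hi, rfl⟩ := Finset.mem_image.1 hx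
    exact hfB i (by simpa [Nat.lt_succ_iff] using hi)
  have hcard : ((Finset.range (N + 1)).image f).card = N + 1 := by
    rw [Finset.card_image_of_injOn (by simpa using hinj'), Finset.card_range]
  refine (card_dissocFinset_le_mul G hsub).trans ?_
  rw [hcard]
  refine Nat.mul_le_mul_right _ ((card_dissocFinset_image_range_le G hinj' fun i h0 hi =>
    hadj i h0 (by omega)).trans ?_)
  rw [← dissocWeight_one, dissocWeight_parentGraph N _ hlt]
  refine elimAll_le_of_elimBound N N _ _ hb ?_ hlt hmono ?_
  · intro i hi
    simp
  · exact (hlt N hN0 le_rfl).le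

theorem card_dissocFinset_le_of_leaves {V : Type*} [Fintype V] [DecidableEq V]
    {G : SimpleGraph V} {x r : V} {L B : Finset V} (hxr : G.Adj x r) (hr : r ∈ B)
    (hL : ∀ u ∈ L, G.Adj x u)
    (hcover : ∀ v, v = x ∨ v ∈ L ∨ v ∈ B)
    (hw : 2 ≤ B.card → ∃ w ∈ B, G.Adj r w) :
    (dissocFinset G Finset.univ).card ≤ 2 ^ L.card * (dissocFinset G B).card +
      (L.card + 1) * 2 ^ (B.card - 1) + 2 ^ (B.card - 2) := by
  obtain ⟨C, hC, hCr⟩ : ∃ C ⊆ B, C.card = B.card - 2 ∧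
      ∀ v ∈ B, v ≠ r → ¬ G.Adj r v → v ∈ C := by
    rcases Nat.lt_or_ge B.card 2 with h | h
    · refine ⟨∅, by simp, by simp; omega, fun v hv hvr => ?_⟩
      exact absurd (Finset.card_le_one.1 (by omega) v hv r hr) hvr
    · obtain ⟨w, hwB, hrw⟩ := hw h
      refine ⟨(B.erase r).erase w, ?_, ?_, ?_⟩
      · exact (Finset.erase_subset _ _).trans (Finset.erase_subset _ _)
      · rw [Finset.card_erase_of_mem (Finset.mem_erase.2 ⟨hrw.ne', hwB⟩),
          Finset.card_erase_of_mem hr]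
        omega
      · intro v hv hvr hnv
        have : v ≠ w := fun h => hnv (h ▸ hrw)
        simp [*]
  have hsub : dissocFinset G Finset.univ ⊆
      ((L.powerset ×ˢ dissocFinset G B).image fun P => P.1 ∪ P.2) ∪
      ((insert ∅ (L.image singleton) ×ˢ (B.erase r).powerset).image
        fun P => insert x (P.1 ∪ P.2)) ∪
      C.powerset.image fun Y => insert x (insert r Y) := by
    intro S hS
    rw [mem_dissocFinset] at hS
    have hS' := isDissociation_iff.1 hS.2
    simp only [Finset.mem_coe] at hS'
    simp only [Finset.mem_union, Finset.mem_image, Finset.mem_product, Finset.mem_powerset,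
      mem_dissocFinset, Finset.mem_insert, Prod.exists]
    by_cases hx : x ∈ S
    · by_cases hrS : r ∈ S
      · refine .inr ⟨S ∩ C, Finset.inter_subset_right, ?_⟩
        ext v
        simp only [Finset.mem_insert, Finset.mem_inter]
        refine ⟨by rintro (rfl | rfl | h) <;> simp_all, fun hv => ?_⟩
        by_contra! hne
        rcases hcover v with h | h | h
        · exact hne.1 h
        · exact hne.2.1 (hS' x hx v hv r hrS (hL v h) hxr)
        · exact hne.2.2 hv (hCr.2 v h hne.2.1 fun hrv =>
            hne.1 (hS' r hrS v hv x hx hrv hxr.symm))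
      · refine .inl (.inr ⟨S ∩ L, S ∩ B.erase r, ⟨?_, Finset.inter_subset_right⟩, ?_⟩)
        · rcases Finset.eq_empty_or_nonempty (S ∩ L) with h | ⟨u, hu⟩
          · exact .inl h
          · rw [Finset.mem_inter] at hu
            refine .inr ⟨u, hu.2, ?_⟩
            ext v
            simp only [Finset.mem_inter, Finset.mem_singleton]
            refine ⟨by rintro rfl; exact hu, fun hv => ?_⟩
            exact hS' x hx v hv.1 u hu.1 (hL v hv.2) (hL u hu.2)
        · ext v
          have := hcover v
          simp only [Finset.mem_insert, Finset.mem_union, Finset.mem_inter, Finset.mem_erase]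
          grind
    · refine .inl (.inl ⟨S ∩ L, S ∩ B, ⟨Finset.inter_subset_right, Finset.inter_subset_right,
        hS.2.mono (by simp)⟩, ?_⟩)
      ext v
      have := hcover v
      simp only [Finset.mem_union, Finset.mem_inter]
      grind
  refine (Finset.card_le_card hsub).trans ((Finset.card_union_le _ _).trans
    (add_le_add ((Finset.card_union_le _ _).trans (add_le_add ?_ ?_)) ?_))
  · refine Finset.card_image_le.trans ?_
    rw [Finset.card_product, Finset.card_powerset]
  · refine Finset.card_image_le.trans ?_
    rw [Finset.card_product, Finset.card_powerset, Finset.card_erase_of_mem hr]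
    refine Nat.mul_le_mul_right _ ((Finset.card_insert_le _ _).trans ?_)
    exact Nat.succ_le_succ Finset.card_image_le
  · refine Finset.card_image_le.trans ?_
    rw [Finset.card_powerset, hCr.1]

/-- The parent function of the tree consisting of `b` paths of length two and further pendant
edges, all attached at the vertex `0`. -/
def legParent (b i : ℕ) : ℕ := if b < i ∧ i ≤ 2 * b then i - b else 0

theorem isTree_comap_parentGraph {p : ℕ → ℕ} (hp : ∀ i, 0 < i → p i < i) (n : ℕ) :
    ((parentGraph p).comap (Fin.valEmbedding (n := n + 1))).IsTree := by
  set G := (parentGraph p).comap (Fin.valEmbedding (n := n + 1)) with hG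
  have hreach : ∀ (i : ℕ) (hi : i < n + 1), G.Reachable ⟨i, hi⟩ 0 := by
    intro i
    induction i using Nat.strong_induction_on with
    | _ i ih =>
      intro hi
      rcases Nat.eq_zero_or_pos i with rfl | h0
      · exact Reachable.refl _
      · have h := hp i h0
        have hadj : G.Adj ⟨i, hi⟩ ⟨p i, by omega⟩ := by
          simp only [hG, comap_adj, Fin.valEmbedding_apply, parentGraph, fromRel_adj]
          exact ⟨h.ne', .inl ⟨h0.ne', trivial⟩⟩
        exact hadj.reachable.trans (ih _ h _)
  have hconn : G.Connected := connected_iff_exists_forall_reachable _ |>.2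
    ⟨0, fun v => (hreach v v.2).symm⟩
  refine isTree_iff_connected_and_card.2 ⟨hconn, le_antisymm ?_ ?_⟩
  · have hlt : ∀ i : Fin n, p (i + 1) < n + 1 := fun i => by
      have := hp (i + 1) (by omega)
      have := i.isLt
      omega
    have hsub : G.edgeSet ⊆ Set.range fun i : Fin n =>
        s(i.succ, (⟨p (i + 1), hlt i⟩ : Fin (n + 1))) := by
      intro e
      induction e using Sym2.ind with
      | _ a c =>
        intro h
        rw [mem_edgeSet] at h
        simp only [hG, comap_adj, Fin.valEmbedding_apply, parentGraph, fromRel_adj] at h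
        rcases h with ⟨-, ⟨h0, h⟩ | ⟨h0, h⟩⟩
        · refine ⟨⟨a - 1, by omega⟩, ?_⟩
          rw [Sym2.eq_iff]
          refine .inl ⟨Fin.ext ?_, Fin.ext ?_⟩
          · simp
            omega
          · simp only
            rw [← h]
            congr 1
            omega
        · refine ⟨⟨c - 1, by omega⟩, ?_⟩
          rw [Sym2.eq_iff]
          refine .inr ⟨Fin.ext ?_, Fin.ext ?_⟩
          · simp
            omega
          · simp only
            rw [← h]
            congr 1
            omega
    have h1 := Set.ncard_le_ncard hsub (Set.toFinite _)
    have h2 : (Set.range fun i : Fin n =>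
        s(i.succ, (⟨p (i + 1), hlt i⟩ : Fin (n + 1)))).ncard ≤ n := by
      rw [← Set.image_univ]
      refine (Set.ncard_image_le (Set.toFinite _)).trans ?_
      simp [Set.ncard_univ]
    rw [Nat.card_coe_set_eq]
    simp only [Nat.card_eq_fintype_card, Fintype.card_fin]
    omega
  · exact hconn.card_vert_le_card_edgeSet_add_one

theorem dissocNum_comap_parentGraph {p : ℕ → ℕ} (hp : ∀ i, 0 < i → p i < i) (n : ℕ) :
    dissocNum ((parentGraph p).comap (Fin.valEmbedding (n := n + 1))) =
      elimAll p (n + 1) fun _ => (1, 1, 0) := by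
  rw [dissocNum_eq_card_dissocFinset, card_dissocFinset_comap, Fin.map_valEmbedding_univ,
    Nat.Iio_eq_range, ← dissocWeight_one, dissocWeight_parentGraph n _ fun i h _ => hp i h]

theorem elimAll_pendant {p : ℕ → ℕ} {N : ℕ} (hp : ∀ i, N < i → p i = 0) (j : ℕ) :
    ∀ w : ℕ → VertexWeight, (∀ i, N < i → w i = (1, 1, 0)) →
    elimAll p (N + 1 + j) w = elimAll p (N + 1)
      (Function.update w 0 (2 ^ j * (w 0).1, (w 0).2.1, (w 0).2.2 + j * (w 0).2.1)) := by
  induction j with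
  | zero =>
    intro w _
    simp
  | succ j ih =>
    intro w hw
    rw [show N + 1 + (j + 1) = (N + j) + 2 by omega, elimAll, hp _ (by omega), hw _ (by omega),
      show N + j + 1 = N + 1 + j by omega, ih]
    · simp only [Function.update_idem, Function.update_self, attachLeaf]
      congr 3 <;> ring_nf
    · intro i hi
      rw [Function.update_of_ne (by omega), hw i hi]

theorem legParent_lt (b : ℕ) : ∀ i, 0 < i → legParent b i < i := by
  intro i hi
  unfold legParent
  split_ifs <;> omega

theorem elimAll_legParent_four (j : ℕ) :
    elimAll (legParent 4) (11 + j) (fun _ => (1, 1, 0)) = 2 ^ (10 + j) + 16 * (j + 5) := by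
  rw [elimAll_pendant (N := 10) (fun i hi => by unfold legParent; rw [if_neg]; omega) j _
    fun _ _ => rfl]
  simp [elimAll, legParent, attachLeaf]
  ring

theorem elimAll_legParent_five (j : ℕ) :
    elimAll (legParent 5) (11 + j) (fun _ => (1, 1, 0)) = 2 ^ (10 + j) + 32 * j + 112 := by
  rw [elimAll_pendant (N := 10) (fun i hi => by unfold legParent; rw [if_neg]; omega) j _
    fun _ _ => rfl]
  simp [elimAll, legParent, attachLeaf]
  ring

/-- A tree with the second-largest number of dissociation sets has at least as many of them as the
tree consisting of four paths of length two and `n - 9` pendant edges attached at one vertex. -/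
theorem SecondLargestTree.le_dissocNum {n : ℕ} (h11 : 11 ≤ n) {T : SimpleGraph (Fin n)}
    (hT : SecondLargestTree n T) : 2 ^ (n - 1) + 16 * (n - 6) ≤ dissocNum T := by
  obtain ⟨j, rfl⟩ : ∃ j, n = 10 + j + 1 := ⟨n - 11, by omega⟩
  have hN : 10 + j + 1 = 11 + j := by omega
  have h4 := (dissocNum_comap_parentGraph (legParent_lt 4) (10 + j)).trans
    ((congrArg (fun N => elimAll _ N _) hN).trans (elimAll_legParent_four j))
  have h5 := (dissocNum_comap_parentGraph (legParent_lt 5) (10 + j)).trans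
    ((congrArg (fun N => elimAll _ N _) hN).trans (elimAll_legParent_five j))
  have h := hT.2.2 _ (isTree_comap_parentGraph (legParent_lt 4) (10 + j))
    ⟨_, isTree_comap_parentGraph (legParent_lt 5) (10 + j), by
      rw [h4, h5]
      omega⟩
  rw [h4] at h
  rwa [show 10 + j + 1 - 1 = 10 + j by omega, show 10 + j + 1 - 6 = j + 5 by omega]

theorem elimBound_three : elimBound 7 2 3 (List.replicate 3 (1, 1, 0)) = true := by
  decide +kernel

theorem elimBound_four : elimBound 13 3 4 (List.replicate 4 (1, 1, 0)) = true := by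
  decide +kernel

theorem elimBound_seven : elimBound 84 6 7 (List.replicate 7 (1, 1, 0)) = true := by
  decide +kernel

theorem elimBound_eight : elimBound 156 7 8 (List.replicate 8 (1, 1, 0)) = true := by
  decide +kernel

theorem elimBound_nine : elimBound 304 8 9 (List.replicate 9 (1, 1, 0)) = true := by
  decide +kernel

theorem elimBound_ten : elimBound 576 9 10 (List.replicate 10 (1, 1, 0)) = true := by
  decide +kernel

/-- If every vertex of `L` is a leaf attached at `x`, the remaining vertices other than `x` form a
connected set `B`, and `x` has a neighbor in `B`, then `G` has few dissociation sets. -/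
theorem card_dissocFinset_lt_of_leaves {V : Type*} [Fintype V] [DecidableEq V]
    {G : SimpleGraph V} {x r : V} {L B : Finset V} (hxr : G.Adj x r) (hr : r ∈ B)
    (hL : ∀ u ∈ L, G.Adj x u) (hcover : ∀ v, v = x ∨ v ∈ L ∨ v ∈ B)
    (hB : ∀ X ⊆ B, r ∈ X → X ≠ B → ∃ x ∈ X, ∃ y ∈ B, y ∉ X ∧ G.Adj x y)
    (hL2 : 2 ≤ L.card) (hn : 11 ≤ L.card + B.card + 1) :
    (dissocFinset G Finset.univ).card <
      2 ^ (L.card + B.card) + 16 * (L.card + B.card - 5) := by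
  have hw : 2 ≤ B.card → ∃ w ∈ B, G.Adj r w := by
    intro h2
    obtain ⟨z, hz, y, hy, -, hzy⟩ := hB {r} (by simpa using hr) (by simp)
      (by rintro h; rw [← h] at h2; simp at h2)
    rw [Finset.mem_singleton] at hz
    exact ⟨y, hy, hz ▸ hzy⟩
  refine (card_dissocFinset_le_of_leaves hxr hr hL hcover hw).trans_lt ?_
  have h0 := card_dissocFinset_le_two_pow G B
  have hbound := fun N b h1 h2 h3 =>
    card_dissocFinset_le_of_elimBound (N := N) (b := b) hr hB h1 h2 h3
  have hpos : 0 < B.card := Finset.card_pos.2 ⟨r, hr⟩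
  generalize (dissocFinset G B).card = c at *
  generalize L.card = k at *
  generalize B.card = m at *
  rcases Nat.lt_or_ge m 3 with hm | hm
  · interval_cases m
    · have : 2 ^ k * c ≤ 2 ^ k * 2 := Nat.mul_le_mul_left _ h0
      rw [pow_add]
      norm_num1
      omega
    · have : 2 ^ k * c ≤ 2 ^ k * 4 := Nat.mul_le_mul_left _ h0
      rw [pow_add]
      norm_num1
      omega
  suffices 2 ^ k * c + (k + 1) * 2 ^ (m - 1) + 2 ^ (m - 2) < 2 ^ (k + m) + 80 by omega
  rcases Nat.lt_or_ge k 5 with hk | hk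
  · interval_cases k
    · rcases Nat.lt_or_ge m 10 with hm' | hm'
      · interval_cases m
        · exact absurd hn (by norm_num)
        · exact absurd hn (by norm_num)
        · exact absurd hn (by norm_num)
        · exact absurd hn (by norm_num)
        · exact absurd hn (by norm_num)
        · have := hbound 7 156 (by norm_num) (by norm_num) elimBound_eight
          norm_num at this ⊢
          omega
        · have := hbound 8 304 (by norm_num) (by norm_num) elimBound_nine
          norm_num at this ⊢
          omega
      · have := hbound 9 576 (by norm_num) hm' elimBound_ten
        obtain ⟨t, rfl⟩ := Nat.exists_eq_add_of_le hm'
        rw [show 10 + t - 1 = 9 + t by omega, show 10 + t - 2 = 8 + t by omega]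
        rw [show 10 + t - (9 + 1) = t by omega] at this
        simp only [pow_add]
        omega
    · have hm' : 7 ≤ m := by omega
      have := hbound 6 84 (by norm_num) hm' elimBound_seven
      obtain ⟨t, rfl⟩ := Nat.exists_eq_add_of_le hm'
      rw [show 7 + t - 1 = 6 + t by omega, show 7 + t - 2 = 5 + t by omega]
      rw [show 7 + t - (6 + 1) = t by omega] at this
      simp only [pow_add]
      omega
    · have hm' : 4 ≤ m := by omega
      have := hbound 3 13 (by norm_num) hm' elimBound_four
      obtain ⟨t, rfl⟩ := Nat.exists_eq_add_of_le hm'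
      rw [show 4 + t - 1 = 3 + t by omega, show 4 + t - 2 = 2 + t by omega]
      rw [show 4 + t - (3 + 1) = t by omega] at this
      simp only [pow_add]
      omega
  · have hc := hbound 2 7 (by norm_num) hm elimBound_three
    obtain ⟨t, rfl⟩ := Nat.exists_eq_add_of_le hm
    rw [show 3 + t - 1 = 2 + t by omega, show 3 + t - 2 = 1 + t by omega]
    rw [show 3 + t - (2 + 1) = t by omega] at hc
    have hk2 : 4 * k + 6 ≤ 2 ^ k := by
      clear * - hk
      induction k, hk using Nat.le_induction with
      | base => norm_num
      | succ k hk ih =>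
        rw [pow_succ]
        omega
    have h1 := Nat.mul_le_mul_left (2 ^ k) hc
    have h2 := Nat.mul_le_mul_right (2 ^ t) hk2
    simp only [pow_add]
    nlinarith

theorem eq_of_adj_of_longest_path {V : Type*} {G : SimpleGraph V} (hG : G.IsAcyclic) {x b : V}
    {q : G.Walk x b} (hq : q.IsPath)
    (hmax : ∀ (c d : V) (r : G.Walk c d), r.IsPath → r.length ≤ q.length + 1) {u w : V}
    (hxu : G.Adj x u) (hu : u ≠ q.snd) (huw : G.Adj u w) : w = x := by
  have huq : u ∉ q.support := fun h => hu (hG.eq_snd_of_adj_start hq hxu h)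
  have hr : (Walk.cons hxu.symm q).IsPath := hq.cons huq
  by_contra hwx
  have hwr : w ∉ (Walk.cons hxu.symm q).support := fun h =>
    hwx (by simpa using hG.eq_snd_of_adj_start hr huw h)
  have := hmax _ _ _ (hr.cons (h := huw.symm) hwr)
  simp at this

theorem exists_isPath_length_eq_two {V : Type*} {G : SimpleGraph V} (hG : G.Connected) {x y z : V}
    (hxy : x ≠ y) (hyz : y ≠ z) (hxz : x ≠ z)
    {N : ℕ} (hN : ∀ (c d : V) (r : G.Walk c d), r.IsPath → r.length ≤ N) : 2 ≤ N := by
  by_contra! hN1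
  have hadj : ∀ {u v : V}, u ≠ v → G.Adj u v := by
    intro u v huv
    obtain ⟨r, hr⟩ := (hG.preconnected u v).exists_isPath
    have h1 := hN u v r hr
    have h0 : r.length ≠ 0 := fun h => huv (Walk.eq_of_length_eq_zero h)
    exact Walk.adj_of_length_eq_one (p := r) (by omega)
  have := hN x z (.cons (hadj hxy) (.cons (hadj hyz) .nil)) (by simp [hxy, hyz, hxz])
  simp at this
  omega

/-- For `n ≥ 11`, in a tree `T` of order `n` with the second-largest number of
dissociation sets, the second vertex `v₁` of any longest path `v₀v₁⋯v_l` has degree 2. -/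
theorem longest_path_second_vertex_degree_two (n : ℕ) (h11 : 11 ≤ n)
    (T : SimpleGraph (Fin n)) (hT : SecondLargestTree n T)
    (a b : Fin n) (p : T.Walk a b) (hp : p.IsPath)
    (hlong : ∀ (c d : Fin n) (q : T.Walk c d), q.IsPath → q.length ≤ p.length) :
    (T.neighborSet (p.getVert 1)).ncard = 2 := by
  classical
  have hlen : 2 ≤ p.length := by
    refine exists_isPath_length_eq_two hT.1.1 (x := ⟨0, by omega⟩) (y := ⟨1, by omega⟩)
      (z := ⟨2, by omega⟩) ?_ ?_ ?_ hlong <;> simp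
  match p, hp, hlong, hlen with
  | .nil, _, _, hlen => simp at hlen
  | .cons _ .nil, _, _, hlen => simp at hlen
  | .cons (v := x) hax (.cons (v := r) hxr q), hp, hlong, _ =>
  have hq := hp.of_cons
  rw [Walk.getVert_cons_succ, Walk.getVert_zero]
  have hleaf : ∀ u w, T.Adj x u → u ≠ r → T.Adj u w → w = x := fun u w hxu hur huw =>
    eq_of_adj_of_longest_path hT.1.2 hq (by simpa using hlong) hxu (by simpa using hur) huw
  have har : a ≠ r := by
    rintro rfl
    simp [Walk.cons_isPath_iff] at hp
  set L : Finset (Fin n) := Finset.univ.filter fun u => T.Adj x u ∧ u ≠ r with hLdef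
  have hmemL : ∀ u, u ∈ L ↔ T.Adj x u ∧ u ≠ r := by simp [hLdef]
  have hrL : r ∉ L := by simp [hmemL]
  have hnbr : T.neighborSet x = ↑(insert r L) := by
    ext u
    simp only [mem_neighborSet, Finset.coe_insert, Set.mem_insert_iff, Finset.mem_coe, hmemL]
    by_cases h : u = r
    · simp [h, hxr]
    · simp [h]
  rw [hnbr, Set.ncard_coe_finset, Finset.card_insert_of_notMem hrL]
  have hL1 : 1 ≤ L.card := Finset.card_pos.2 ⟨a, (hmemL a).2 ⟨hax.symm, har⟩⟩
  by_contra hne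
  set B : Finset (Fin n) := (insert x L)ᶜ with hBdef
  have hmemB : ∀ v, v ∈ B ↔ v ≠ x ∧ v ∉ L := by simp [hBdef]
  have hxL : x ∉ L := by simp [hmemL]
  have hcard : L.card + B.card + 1 = n := by
    have := Finset.card_add_card_compl (insert x L)
    rw [Finset.card_insert_of_notMem hxL, Fintype.card_fin, ← hBdef] at this
    omega
  have hlt := card_dissocFinset_lt_of_leaves hxr ((hmemB r).2 ⟨hxr.ne', hrL⟩)
    (fun u hu => ((hmemL u).1 hu).1) (B := B)
    (fun v => by by_cases h1 : v = x <;> by_cases h2 : v ∈ L <;> simp [h1, h2, hmemB]) (by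
      intro X hXB hrX hX
      obtain ⟨y, hyB, hyX⟩ := Finset.exists_of_ssubset (hXB.ssubset_of_ne hX)
      obtain ⟨w⟩ := hT.1.1.preconnected r y
      obtain ⟨d, -, hd1, hd2⟩ := w.exists_boundary_dart {v | v ∈ X ∨ v ∉ B} (.inl hrX)
        (by simp [hyB, hyX])
      have hadj := d.adj
      generalize d.fst = s at hd1 hadj
      generalize d.snd = t at hd2 hadj
      simp only [Set.mem_ofPred_eq, not_or, not_not] at hd1 hd2
      refine ⟨s, ?_, t, hd2.2, hd2.1, hadj⟩
      by_contra hsX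
      have hsB := hd1.resolve_left hsX
      have htB := (hmemB t).1 hd2.2
      simp only [hmemB, not_and_or, not_not] at hsB
      rcases hsB with rfl | hsL
      · refine htB.2 ((hmemL t).2 ⟨hadj, ?_⟩)
        rintro rfl
        exact hd2.1 hrX
      · obtain ⟨hxs, hsr⟩ := (hmemL s).1 hsL
        exact htB.1 (hleaf s t hxs hsr hadj)) (by omega) (by omega)
  have hge := hT.le_dissocNum h11
  rw [dissocNum_eq_card_dissocFinset] at hge
  rw [show L.card + B.card = n - 1 by omega, show n - 1 - 5 = n - 6 by omega] at hlt
  omega
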